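/- arXiv:2603.21021 — 3 statements merged into one kernel-verified Lean document; each statement's English description precedes it below -/
import Mathlib

section
/- Let m and n be positive integers with m even, and let A and B be m×n matrices over a commutative ring. Then Σ_{1≤i_1≤j_1<i_2≤j_2<⋯<i_{m/2}≤j_{m/2}≤n} det(A^{i_1} B^{j_1} A^{i_2} B^{j_2} ⋯ A^{i_{m/2}} B^{j_{m/2}}) = Pf(A·(U_n + Id_n)·Bᵗ − B·(U_nᵗ + Id_n)·Aᵗ). -/
open Matrix

/-- The Pfaffian of a `2k × 2k` matrix, defined as the sum over perfect matchings
of `{1, …, 2k}` (encoded by the permutation listing the matched pairs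
`(σ(1),σ(2)), (σ(3),σ(4)), …` in normal form, whose sign equals
`(−1)^{cr(μ)}` for the matching `μ`) of the sign of the matching times the
product of the corresponding matrix entries. -/
def pfaffian {R : Type*} [CommRing R] {k : ℕ} (Y : Matrix (Fin (2*k)) (Fin (2*k)) R) : R :=
  ∑ σ ∈ Finset.univ.filter (fun σ : Equiv.Perm (Fin (2*k)) =>
      (∀ i : Fin k,
        σ ⟨2*(i:ℕ), by have := i.isLt; omega⟩ < σ ⟨2*(i:ℕ)+1, by have := i.isLt; omega⟩) ∧
      (∀ i j : Fin k, i < j →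
        σ ⟨2*(i:ℕ), by have := i.isLt; omega⟩ < σ ⟨2*(j:ℕ), by have := j.isLt; omega⟩)),
    ((Equiv.Perm.sign σ : ℤ) : R) *
      ∏ i : Fin k, Y (σ ⟨2*(i:ℕ), by have := i.isLt; omega⟩) (σ ⟨2*(i:ℕ)+1, by have := i.isLt; omega⟩)

/-- The `n × n` strictly upper triangular matrix `U_n` with all entries above the
diagonal equal to `1` and all other entries equal to `0`. -/
def upperTri (R : Type*) [CommRing R] (n : ℕ) : Matrix (Fin n) (Fin n) R :=
  Matrix.of fun i j => if i < j then 1 else 0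

theorem avg_lemma {G X R : Type*} [Fintype G] [Fintype X] [CommRing R]
    (act : G → Equiv.Perm X) (F : X → R) (hF : ∀ g x, F (act g x) = F x)
    (q p : X → Prop) [DecidablePred q] [DecidablePred p]
    (hq : ∀ g x, q (act g x) ↔ q x)
    (hu : ∀ x, q x → ∃! g, p (act g x)) :
    ∑ x ∈ Finset.univ.filter q, F x
      = (Fintype.card G : R) * ∑ x ∈ Finset.univ.filter (fun x => q x ∧ p x), F x := by
  classical
  have h1 : ∀ g : G, ∑ x, (if q (act g x) ∧ p (act g x) then F (act g x) else 0)
      = ∑ x ∈ Finset.univ.filter (fun x => q x ∧ p x), F x := by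
    intro g
    rw [Finset.sum_filter]
    exact Equiv.sum_comp (act g) (fun x => if q x ∧ p x then F x else 0)
  have h2 : ∑ g : G, ∑ x, (if q (act g x) ∧ p (act g x) then F (act g x) else 0)
      = (Fintype.card G : R) * ∑ x ∈ Finset.univ.filter (fun x => q x ∧ p x), F x := by
    rw [Finset.sum_congr rfl (fun g _ => h1 g)]
    simp
  rw [← h2, Finset.sum_comm, Finset.sum_filter]
  refine Finset.sum_congr rfl fun x _ => ?_
  split_ifs with hx
  · obtain ⟨g, hg, hg'⟩ := hu x hx
    rw [Finset.sum_eq_single g]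
    · rw [if_pos ⟨(hq g x).2 hx, hg⟩, hF]
    · intro g2 _ hne
      rw [if_neg]
      rintro ⟨_, h⟩
      exact hne (hg' g2 h)
    · simp
  · symm
    apply Finset.sum_eq_zero
    intro g _
    rw [if_neg]
    rintro ⟨h, _⟩
    exact hx ((hq g x).1 h)

theorem existsUnique_sort {k : ℕ} {α : Type*} [LinearOrder α] (h : Fin k → α)
    (hi : Function.Injective h) : ∃! g : Equiv.Perm (Fin k), StrictMono (h ∘ g) := by
  refine ⟨Tuple.sort h, (Tuple.monotone_sort h).strictMono_of_injective
    (hi.comp (Equiv.injective _)), ?_⟩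
  intro g hg
  have := Tuple.unique_monotone hg.monotone (Tuple.monotone_sort h)
  ext i
  have := congrFun this i
  exact congrArg _ (hi this)

def pairE (k : ℕ) : Fin k × Fin 2 ≃ Fin (2*k) :=
  finProdFinEquiv.trans (finCongr (Nat.mul_comm k 2))

theorem pairE_val (k : ℕ) (i : Fin k) (b : Fin 2) : (pairE k (i, b) : ℕ) = 2 * i + b := by
  simp [pairE, finProdFinEquiv]; omega

theorem pairE_zero (k : ℕ) (i : Fin k) (h : 2 * (i:ℕ) < 2 * k) :
    (⟨2 * (i:ℕ), h⟩ : Fin (2*k)) = pairE k (i, 0) := by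
  ext; simp [pairE_val]

theorem pairE_one (k : ℕ) (i : Fin k) (h : 2 * (i:ℕ) + 1 < 2 * k) :
    (⟨2 * (i:ℕ) + 1, h⟩ : Fin (2*k)) = pairE k (i, 1) := by
  ext; simp [pairE_val]

def blockP {k : ℕ} (g : Equiv.Perm (Fin k)) : Equiv.Perm (Fin (2*k)) :=
  (pairE k).permCongr (Equiv.prodCongrLeft (fun _ : Fin 2 => g))

def flipP {k : ℕ} (e : Fin k → Equiv.Perm (Fin 2)) : Equiv.Perm (Fin (2*k)) :=
  (pairE k).permCongr (Equiv.prodCongrRight e)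

theorem blockP_apply {k : ℕ} (g : Equiv.Perm (Fin k)) (i : Fin k) (b : Fin 2) :
    blockP g (pairE k (i, b)) = pairE k (g i, b) := by
  simp [blockP, Equiv.permCongr_apply]

theorem flipP_apply {k : ℕ} (e : Fin k → Equiv.Perm (Fin 2)) (i : Fin k) (b : Fin 2) :
    flipP e (pairE k (i, b)) = pairE k (i, e i b) := by
  simp [flipP, Equiv.permCongr_apply]

theorem sign_blockP {k : ℕ} (g : Equiv.Perm (Fin k)) : Equiv.Perm.sign (blockP g) = 1 := by
  rw [blockP, Equiv.Perm.sign_permCongr, Equiv.Perm.sign_prodCongrLeft]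
  simp

theorem sign_flipP {k : ℕ} (e : Fin k → Equiv.Perm (Fin 2)) :
    Equiv.Perm.sign (flipP e) = ∏ i, Equiv.Perm.sign (e i) := by
  rw [flipP, Equiv.Perm.sign_permCongr, Equiv.Perm.sign_prodCongrRight]

def pfTerm {R : Type*} [CommRing R] {k : ℕ} (Y : Matrix (Fin (2*k)) (Fin (2*k)) R)
    (σ : Equiv.Perm (Fin (2*k))) : R :=
  ((Equiv.Perm.sign σ : ℤ) : R) * ∏ i : Fin k, Y (σ (pairE k (i, 0))) (σ (pairE k (i, 1)))

theorem pfaffian_eq {R : Type*} [CommRing R] {k : ℕ} (Y : Matrix (Fin (2*k)) (Fin (2*k)) R) :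
    pfaffian Y = ∑ σ ∈ Finset.univ.filter (fun σ : Equiv.Perm (Fin (2*k)) =>
      (∀ i : Fin k, σ (pairE k (i, 0)) < σ (pairE k (i, 1))) ∧
      (∀ i j : Fin k, i < j → σ (pairE k (i, 0)) < σ (pairE k (j, 0)))), pfTerm Y σ := by
  simp only [pfaffian, pfTerm, pairE_zero, pairE_one]

theorem pfTerm_block {R : Type*} [CommRing R] {k : ℕ} (Y : Matrix (Fin (2*k)) (Fin (2*k)) R)
    (g : Equiv.Perm (Fin k)) (σ : Equiv.Perm (Fin (2*k))) :
    pfTerm Y (σ * blockP g) = pfTerm Y σ := by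
  simp only [pfTerm, Equiv.Perm.sign_mul, sign_blockP, mul_one, Equiv.Perm.mul_apply, blockP_apply]
  congr 1
  exact Equiv.prod_comp g (fun i => Y (σ (pairE k (i, 0))) (σ (pairE k (i, 1))))

theorem perm_fin_two (p : Equiv.Perm (Fin 2)) : p = 1 ∨ p = Equiv.swap 0 1 := by
  revert p; decide

theorem pfTerm_flip {R : Type*} [CommRing R] {k : ℕ} (Y : Matrix (Fin (2*k)) (Fin (2*k)) R)
    (hY : ∀ i j, Y i j = - Y j i)
    (e : Fin k → Equiv.Perm (Fin 2)) (σ : Equiv.Perm (Fin (2*k))) :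
    pfTerm Y (σ * flipP e) = pfTerm Y σ := by
  simp only [pfTerm, Equiv.Perm.sign_mul, sign_flipP, Equiv.Perm.mul_apply, flipP_apply]
  push_cast
  rw [mul_assoc, ← Finset.prod_mul_distrib]
  congr 1
  refine Finset.prod_congr rfl fun i _ => ?_
  rcases perm_fin_two (e i) with h | h
  · simp [h]
  · rw [h, Equiv.Perm.sign_swap (by decide), Equiv.swap_apply_left, Equiv.swap_apply_right, hY]
    simp

theorem sum_pfTerm {R : Type*} [CommRing R] {k : ℕ} (Y : Matrix (Fin (2*k)) (Fin (2*k)) R)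
    (hY : ∀ i j, Y i j = - Y j i) :
    ∑ σ, pfTerm Y σ = (2 ^ k : R) * ((k.factorial : R) * pfaffian Y) := by
  have h1 := avg_lemma (G := Fin k → Equiv.Perm (Fin 2))
    (fun e => Equiv.mulRight (flipP e)) (pfTerm Y) (fun g x => pfTerm_flip Y hY g x)
    (fun _ => True) (fun σ => ∀ i : Fin k, σ (pairE k (i, 0)) < σ (pairE k (i, 1)))
    (fun _ _ => Iff.rfl) (by
      intro σ _
      refine ⟨fun i => if σ (pairE k (i, 0)) < σ (pairE k (i, 1)) then 1 else Equiv.swap 0 1, ?_, ?_⟩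
      · intro i
        simp only [Equiv.coe_mulRight, Equiv.Perm.mul_apply, flipP_apply]
        split_ifs with h
        · simpa using h
        · simp only [Equiv.swap_apply_left, Equiv.swap_apply_right]
          refine lt_of_le_of_ne (not_lt.1 h) ?_
          intro h
          have := (pairE k).injective (σ.injective h)
          simp at this
      · intro e he
        funext i
        have := he i
        simp only [Equiv.coe_mulRight, Equiv.Perm.mul_apply, flipP_apply] at this
        rcases perm_fin_two (e i) with h | h <;> rw [h] at this ⊢
        · rw [if_pos]; simpa using this
        · rw [if_neg]; simp only [Equiv.swap_apply_left, Equiv.swap_apply_right] at this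
          exact this.asymm)
  have h2 := avg_lemma (G := Equiv.Perm (Fin k))
    (fun e => Equiv.mulRight (blockP e)) (pfTerm Y) (fun g x => pfTerm_block Y g x)
    (fun σ => ∀ i : Fin k, σ (pairE k (i, 0)) < σ (pairE k (i, 1)))
    (fun σ => ∀ i j : Fin k, i < j → σ (pairE k (i, 0)) < σ (pairE k (j, 0)))
    (by
      intro g σ
      simp only [Equiv.coe_mulRight, Equiv.Perm.mul_apply, blockP_apply]
      exact ⟨fun h i => by simpa using h (g.symm i), fun h i => h (g i)⟩)
    (by
      intro σ _
      simp only [Equiv.coe_mulRight, Equiv.Perm.mul_apply, blockP_apply]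
      refine existsUnique_sort (fun i => σ (pairE k (i, 0))) ?_
      intro i j h
      have := (pairE k).injective (σ.injective h)
      simpa using this)
  rw [pfaffian_eq]
  simp only [true_and, Finset.filter_true] at h1
  rw [h1, h2]
  simp [Fintype.card_perm]

theorem pfTerm_sub {R : Type*} [CommRing R] {k : ℕ} (C : Matrix (Fin (2*k)) (Fin (2*k)) R) :
    ∑ σ, pfTerm (C - Cᵀ) σ = (2 ^ k : R) * ∑ σ, pfTerm C σ := by
  have key : ∀ σ, pfTerm (C - Cᵀ) σ
      = ∑ e : Fin k → Equiv.Perm (Fin 2), pfTerm C (σ * flipP e) := by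
    intro σ
    simp only [pfTerm, Equiv.Perm.sign_mul, sign_flipP, Equiv.Perm.mul_apply, flipP_apply]
    push_cast
    simp only [mul_assoc, ← Finset.prod_mul_distrib]
    rw [← Finset.mul_sum]
    congr 1
    rw [← Fintype.prod_sum (fun (i : Fin k) (p : Equiv.Perm (Fin 2)) =>
      ((Equiv.Perm.sign p : ℤ) : R) * C (σ (pairE k (i, p 0))) (σ (pairE k (i, p 1))))]
    refine Finset.prod_congr rfl fun i _ => ?_
    have : (Finset.univ : Finset (Equiv.Perm (Fin 2))) = {1, Equiv.swap 0 1} := by decide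
    rw [this, Finset.sum_pair (by decide), Equiv.Perm.sign_swap (by decide)]
    simp [sub_eq_add_neg]
  simp only [key]
  rw [Finset.sum_comm]
  have : ∀ e : Fin k → Equiv.Perm (Fin 2), ∑ σ, pfTerm C (σ * flipP e) = ∑ σ, pfTerm C σ :=
    fun e => Equiv.sum_comp (Equiv.mulRight (flipP e)) (pfTerm C)
  simp only [this]
  simp [Fintype.card_perm]

def sbMat {R : Type*} [CommRing R] {k n : ℕ} (S B : Matrix (Fin (2*k)) (Fin n) R)
    (f : Fin k → Fin n) : Matrix (Fin (2*k)) (Fin (2*k)) R :=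
  Matrix.of fun r c => if (c:ℕ) % 2 = 0 then S r (f ((pairE k).symm c).1)
    else B r (f ((pairE k).symm c).1)

theorem sbMat_zero {R : Type*} [CommRing R] {k n : ℕ} (S B : Matrix (Fin (2*k)) (Fin n) R)
    (f : Fin k → Fin n) (r) (i : Fin k) : sbMat S B f r (pairE k (i, 0)) = S r (f i) := by
  simp [sbMat, pairE_val]

theorem sbMat_one {R : Type*} [CommRing R] {k n : ℕ} (S B : Matrix (Fin (2*k)) (Fin n) R)
    (f : Fin k → Fin n) (r) (i : Fin k) : sbMat S B f r (pairE k (i, 1)) = B r (f i) := by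
  simp [sbMat, pairE_val]

theorem det_sbMat {R : Type*} [CommRing R] {k n : ℕ} (S B : Matrix (Fin (2*k)) (Fin n) R)
    (f : Fin k → Fin n) : (sbMat S B f).det = ∑ σ : Equiv.Perm (Fin (2*k)),
      ((Equiv.Perm.sign σ : ℤ) : R) *
        ∏ i : Fin k, S (σ (pairE k (i, 0))) (f i) * B (σ (pairE k (i, 1))) (f i) := by
  rw [Matrix.det_apply']
  refine Finset.sum_congr rfl fun σ _ => ?_
  congr 1
  rw [← (pairE k).prod_comp, Fintype.prod_prod_type]
  refine Finset.prod_congr rfl fun i _ => ?_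
  rw [Fin.prod_univ_two, sbMat_zero, sbMat_one]

theorem sum_pfTerm_mul {R : Type*} [CommRing R] {k n : ℕ} (S B : Matrix (Fin (2*k)) (Fin n) R) :
    ∑ σ, pfTerm (S * Bᵀ) σ = ∑ f : Fin k → Fin n, (sbMat S B f).det := by
  simp only [det_sbMat]
  rw [Finset.sum_comm]
  refine Finset.sum_congr rfl fun σ _ => ?_
  rw [pfTerm, ← Finset.mul_sum]
  congr 1
  rw [← Fintype.prod_sum (fun (i : Fin k) (j : Fin n) =>
    S (σ (pairE k (i, 0))) j * B (σ (pairE k (i, 1))) j)]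
  rfl

theorem det_sbMat_noninj {R : Type*} [CommRing R] {k n : ℕ} (S B : Matrix (Fin (2*k)) (Fin n) R)
    (f : Fin k → Fin n) (hf : ¬ Function.Injective f) : (sbMat S B f).det = 0 := by
  simp only [Function.Injective, not_forall] at hf
  obtain ⟨i, j, hij, hne⟩ := hf
  apply Matrix.det_zero_of_column_eq (i := pairE k (i, 0)) (j := pairE k (j, 0))
  · intro h
    have := (pairE k).injective h
    simp at this
    exact hne this
  · intro r
    rw [sbMat_zero, sbMat_zero, hij]

theorem det_sbMat_perm {R : Type*} [CommRing R] {k n : ℕ} (S B : Matrix (Fin (2*k)) (Fin n) R)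
    (f : Fin k → Fin n) (g : Equiv.Perm (Fin k)) :
    (sbMat S B (f ∘ g)).det = (sbMat S B f).det := by
  have : sbMat S B (f ∘ g) = (sbMat S B f).submatrix id (blockP g) := by
    ext r c
    obtain ⟨⟨i, b⟩, rfl⟩ := (pairE k).surjective c
    rw [Matrix.submatrix_apply, blockP_apply]
    fin_cases b
    · exact (sbMat_zero ..).trans (sbMat_zero S B f r (g i)).symm
    · exact (sbMat_one ..).trans (sbMat_one S B f r (g i)).symm
  rw [this, Matrix.det_permute', sign_blockP]
  simp

theorem sum_det_all {R : Type*} [CommRing R] {k n : ℕ} (S B : Matrix (Fin (2*k)) (Fin n) R) :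
    ∑ f : Fin k → Fin n, (sbMat S B f).det
      = (k.factorial : R) * ∑ f ∈ Finset.univ.filter (fun f : Fin k → Fin n => StrictMono f),
        (sbMat S B f).det := by
  classical
  have h := avg_lemma (G := Equiv.Perm (Fin k)) (X := Fin k → Fin n)
    (fun g => Equiv.arrowCongr g.symm (Equiv.refl _)) (fun f => (sbMat S B f).det)
    (fun g f => det_sbMat_perm S B f g)
    Function.Injective StrictMono
    (fun g f => by
      show Function.Injective (f ∘ g) ↔ _
      exact g.injective_comp f)
    (fun f hf => existsUnique_sort f hf)
  have h2 : (fun f : Fin k → Fin n => Function.Injective f ∧ StrictMono f) = StrictMono := by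
    funext f
    exact propext ⟨fun h => h.2, fun h => ⟨h.injective, h⟩⟩
  rw [Fintype.card_perm, Fintype.card_fin] at h
  have h3 : ∑ f : Fin k → Fin n, (sbMat S B f).det
    = ∑ f ∈ Finset.univ.filter (fun f : Fin k → Fin n => Function.Injective f), (sbMat S B f).det := by
    rw [Finset.sum_filter]
    refine Finset.sum_congr rfl fun f _ => ?_
    split_ifs with hf
    · rfl
    · exact det_sbMat_noninj S B f hf
  rw [h3, h]
  congr 2
  ext f
  simp only [Finset.mem_filter]
  exact ⟨fun h => ⟨h.1, h.2.2⟩, fun h => ⟨h.1, h.2.injective, h.2⟩⟩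

theorem pf_domain {R : Type*} [CommRing R] [IsDomain R] [CharZero R] {k n : ℕ}
    (S B : Matrix (Fin (2*k)) (Fin n) R) :
    pfaffian (S * Bᵀ - B * Sᵀ)
      = ∑ f ∈ Finset.univ.filter (fun f : Fin k → Fin n => StrictMono f), (sbMat S B f).det := by
  have e : B * Sᵀ = (S * Bᵀ)ᵀ := by simp
  have h1 := sum_pfTerm (S * Bᵀ - B * Sᵀ) (by
    intro i j; rw [e]; simp only [Matrix.sub_apply, Matrix.transpose_apply]; ring)
  rw [e] at h1 ⊢
  rw [pfTerm_sub, sum_pfTerm_mul, sum_det_all] at h1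
  have h2 : (2 ^ k : R) ≠ 0 := pow_ne_zero _ two_ne_zero
  have h3 : (k.factorial : R) ≠ 0 := by exact_mod_cast k.factorial_ne_zero
  exact (mul_left_cancel₀ h3 (mul_left_cancel₀ h2 h1)).symm

theorem pfaffian_map {R R' : Type*} [CommRing R] [CommRing R'] (φ : R →+* R') {k : ℕ}
    (Y : Matrix (Fin (2*k)) (Fin (2*k)) R) : pfaffian (Y.map φ) = φ (pfaffian Y) := by
  simp [pfaffian, map_sum, map_mul, map_prod]

theorem sbMat_map {R R' : Type*} [CommRing R] [CommRing R'] (φ : R →+* R') {k n : ℕ}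
    (S B : Matrix (Fin (2*k)) (Fin n) R) (f : Fin k → Fin n) :
    sbMat (S.map φ) (B.map φ) f = (sbMat S B f).map φ := by
  ext r c
  simp only [sbMat, Matrix.map_apply, Matrix.of_apply]
  split_ifs <;> rfl

theorem pf_general {R : Type*} [CommRing R] {k n : ℕ}
    (S B : Matrix (Fin (2*k)) (Fin n) R) :
    pfaffian (S * Bᵀ - B * Sᵀ)
      = ∑ f ∈ Finset.univ.filter (fun f : Fin k → Fin n => StrictMono f), (sbMat S B f).det := by
  let V := (Fin (2*k) × Fin n) ⊕ (Fin (2*k) × Fin n)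
  let φ : MvPolynomial V ℤ →+* R := MvPolynomial.eval₂Hom (Int.castRingHom R)
    (Sum.elim (fun p => S p.1 p.2) (fun p => B p.1 p.2))
  let S' : Matrix (Fin (2*k)) (Fin n) (MvPolynomial V ℤ) :=
    Matrix.of fun i j => MvPolynomial.X (Sum.inl (i, j))
  let B' : Matrix (Fin (2*k)) (Fin n) (MvPolynomial V ℤ) :=
    Matrix.of fun i j => MvPolynomial.X (Sum.inr (i, j))
  have hS : S = S'.map φ := by ext i j; simp [S', φ]
  have hB : B = B'.map φ := by ext i j; simp [B', φ]
  have h := congrArg φ (pf_domain S' B')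
  rw [← pfaffian_map, map_sum] at h
  rw [hS, hB]
  simp only [sbMat_map]
  convert h using 2
  · ext i j
    simp [Matrix.mul_apply, map_sum]
  · exact (RingHom.map_det φ _).symm

def chainG {M : Type*} [Ring M] (e : ℕ → ℕ) (x : ℕ → ℕ → M) : ℕ → ℕ → M
  | 0, _ => 1
  | L + 1, m => ∑ j ∈ Finset.range m, chainG e x L (j + e L) * x L j

theorem sum_chain {M : Type*} [Ring M] (e : ℕ → ℕ) (x : ℕ → ℕ → M) (n : ℕ)
    (he : ∀ L, e L ≤ 1) (L : ℕ) : ∀ m ≤ n,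
    ∑ d ∈ Finset.univ.filter (fun d : Fin L → Fin n =>
      (∀ s t : Fin L, (s:ℕ) + 1 = t → (d s : ℕ) < d t + e t) ∧
      (∀ i : Fin L, (i:ℕ) + 1 = L → (d i : ℕ) < m)),
      (List.ofFn fun i : Fin L => x i (d i)).prod = chainG e x L m := by
  classical
  induction L with
  | zero =>
    intro m _
    rw [Finset.sum_filter]
    simp [chainG]
  | succ L ih =>
    intro m hm
    rw [Finset.sum_filter, ← (Fin.snocEquiv (fun _ => Fin n)).sum_comp, Fintype.sum_prod_type]
    have h1 : ∀ j : Fin n, (∑ d : Fin L → Fin n,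
        if (∀ s t : Fin (L+1), (s:ℕ) + 1 = t →
            ((Fin.snocEquiv (fun _ => Fin n) (j, d)) s : ℕ)
              < (Fin.snocEquiv (fun _ => Fin n) (j, d)) t + e t) ∧
          (∀ i : Fin (L+1), (i:ℕ) + 1 = L+1 →
            ((Fin.snocEquiv (fun _ => Fin n) (j, d)) i : ℕ) < m) then
          (List.ofFn fun i : Fin (L+1) => x i (Fin.snocEquiv (fun _ => Fin n) (j, d) i)).prod else 0)
        = if (j:ℕ) < m then chainG e x L (j + e L) * x L j else 0 := by
      intro j
      have hj : (j:ℕ) + e L ≤ n := by have := he L; omega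
      rw [← ih _ hj, Finset.sum_filter, Finset.sum_mul]
      split_ifs with hjm
      · refine Finset.sum_congr rfl fun d _ => ?_
        rw [ite_mul, zero_mul]
        refine if_congr ?_ ?_ rfl
        · simp only [Fin.snocEquiv, Equiv.coe_fn_mk]
          constructor
          · rintro ⟨h, -⟩
            refine ⟨fun s t hst => ?_, fun i hi => ?_⟩
            · simpa using h s.castSucc t.castSucc (by simpa using hst)
            · simpa using h i.castSucc (Fin.last L) (by simpa using hi)
          · rintro ⟨h, h'⟩
            refine ⟨fun s t => ?_, fun i hi => ?_⟩
            · refine Fin.lastCases ?_ (fun t => ?_) t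
              · refine Fin.lastCases ?_ (fun s => ?_) s
                · intro hst; simp at hst
                · intro hst; simpa using h' s (by simpa using hst)
              · refine Fin.lastCases ?_ (fun s => ?_) s
                · intro hst; have := t.isLt; simp at hst; omega
                · intro hst; simpa using h s t (by simpa using hst)
            · have : i = Fin.last L := by ext; simp; omega
              subst this
              simpa using hjm
        · rw [List.ofFn_succ', List.concat_eq_append, List.prod_append]
          simp [Fin.snocEquiv]
      · refine Finset.sum_eq_zero fun d _ => ?_
        rw [if_neg]
        rintro ⟨-, h⟩
        apply hjm
        simpa [Fin.snocEquiv] using h (Fin.last L) (by simp)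
    rw [Finset.sum_congr rfl (fun j _ => h1 j)]
    rw [Fin.sum_univ_eq_sum_range (fun j => if j < m then chainG e x L (j + e L) * x L j else 0)]
    rw [chainG, ← Finset.sum_filter]
    congr 1
    ext j
    simp
    omega

theorem chain_pq {M : Type*} [Ring M] (a b s : ℕ → M)
    (hs : ∀ j, s j = ∑ i ∈ Finset.range (j+1), a i)
    (h0 : ∀ j, s j * b j * s j = 0) (k : ℕ) : ∀ m,
    chainG (fun _ => 0) (fun _ j => s j * b j) k m
      = chainG (fun c => c % 2) (fun c j => if c % 2 = 0 then a j else b j) (2*k) m := by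
  induction k with
  | zero => intro m; rfl
  | succ k ih =>
    intro m
    rw [show 2 * (k+1) = 2*k+1+1 by ring]
    set P := chainG (fun _ => 0) (fun _ j => s j * b j) with hP
    have key : ∀ j, ∑ i ∈ Finset.range (j+1), P k i * a i = P k j * s j := by
      intro j
      induction j with
      | zero => simp [hs]
      | succ j ihj =>
        rw [Finset.sum_range_succ, ihj]
        have e1 : s (j+1) = s j + a (j+1) := by
          rw [hs, hs, Finset.sum_range_succ]
        have e2 : P k (j+1) * s j = P k j * s j := by
          cases k with
          | zero => rfl
          | succ k =>
            have : P (k+1) (j+1) = P (k+1) j + P k j * (s j * b j) := by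
              simp only [hP, chainG, Finset.sum_range_succ, add_zero]
            rw [this, add_mul, mul_assoc (P k j), h0, mul_zero, add_zero]
        rw [e1, mul_add, e2]
    rw [chainG]
    have : P (k+1) m = ∑ j ∈ Finset.range m, P k j * (s j * b j) := by
      simp only [hP, chainG, add_zero]
    rw [this]
    refine Finset.sum_congr rfl fun j _ => ?_
    have o1 : (2*k+1) % 2 = 1 := by omega
    have o2 : (2*k) % 2 = 0 := by omega
    simp only [o1, one_ne_zero, if_false]
    rw [chainG]
    simp only [o2, if_true, add_zero, ← ih]
    rw [key, mul_assoc]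

theorem prod_pairs {M : Type*} [Ring M] (u : ℕ → M) (k : ℕ) :
    (List.ofFn (fun c : Fin (2*k) => u c)).prod
      = (List.ofFn (fun i : Fin k => u (2*i) * u (2*i+1))).prod := by
  induction k with
  | zero => rfl
  | succ k ih =>
    rw [List.ofFn_succ' (n := k), List.concat_eq_append, List.prod_append]
    show (List.ofFn (fun c : Fin (2*k+1+1) => u c)).prod = _
    rw [List.ofFn_succ', List.concat_eq_append, List.prod_append, List.ofFn_succ',
      List.concat_eq_append, List.prod_append]
    simp only [Fin.val_castSucc, Fin.val_last, List.prod_singleton]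
    rw [ih, mul_assoc]

noncomputable def detFun (R : Type*) [CommRing R] (N : ℕ) :
    ExteriorAlgebra R (Fin N → R) →ₗ[R] R :=
  ExteriorAlgebra.liftAlternating
    (fun i => if h : i = N then h ▸ Matrix.detRowAlternating else 0)

theorem detFun_prod {R : Type*} [CommRing R] {N : ℕ} (X : Matrix (Fin N) (Fin N) R) :
    detFun R N (List.ofFn fun c => ExteriorAlgebra.ι R (fun r => X r c)).prod = X.det := by
  rw [← Matrix.det_transpose, ← ExteriorAlgebra.ιMulti_apply, detFun,
    ExteriorAlgebra.liftAlternating_apply_ιMulti, dif_pos rfl]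
  rfl

theorem sum_strictMono_eq {R : Type*} [CommRing R] (k n : ℕ)
    (A B S : Matrix (Fin (2*k)) (Fin n) R)
    (hS : ∀ r j, S r j = ∑ i, if i ≤ j then A r i else 0) :
    ∑ f ∈ Finset.univ.filter (fun f : Fin k → Fin n => StrictMono f), (sbMat S B f).det
    = (∑ d ∈ Finset.univ.filter (fun d : Fin (2*k) → Fin n =>
        ∀ s t : Fin (2*k), (s:ℕ) + 1 = (t:ℕ) →
          ((s:ℕ) % 2 = 0 → d s ≤ d t) ∧ ((s:ℕ) % 2 = 1 → d s < d t)),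
      (Matrix.of fun r c : Fin (2*k) =>
        if (c:ℕ) % 2 = 0 then A r (d c) else B r (d c)).det) := by
  classical
  let a : ℕ → ExteriorAlgebra R (Fin (2*k) → R) := fun j =>
    ExteriorAlgebra.ι R (if h : j < n then fun r => A r ⟨j, h⟩ else 0)
  let b : ℕ → ExteriorAlgebra R (Fin (2*k) → R) := fun j =>
    ExteriorAlgebra.ι R (if h : j < n then fun r => B r ⟨j, h⟩ else 0)
  let s : ℕ → ExteriorAlgebra R (Fin (2*k) → R) := fun j => ∑ i ∈ Finset.range (j+1), a i
  have ha : ∀ j : Fin n, a j = ExteriorAlgebra.ι R (fun r => A r j) := by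
    intro j; simp [a]
  have hb : ∀ j : Fin n, b j = ExteriorAlgebra.ι R (fun r => B r j) := by
    intro j; simp [b]
  have hs : ∀ j : Fin n, s j = ExteriorAlgebra.ι R (fun r => S r j) := by
    intro j
    have : (fun r => S r j) = ∑ i : Fin n, if (i:ℕ) < j + 1 then (fun r => A r i) else 0 := by
      funext r
      rw [hS, Finset.sum_apply]
      refine Finset.sum_congr rfl fun i _ => ?_
      by_cases h : i ≤ j
      · rw [if_pos h, if_pos (by have : (i:ℕ) ≤ j := h; omega)]
      · rw [if_neg h, if_neg (by have : ¬ (i:ℕ) ≤ j := h; omega)]; rfl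
    rw [this, map_sum]
    have h2 : ∀ i : Fin n, ExteriorAlgebra.ι R (if (i:ℕ) < j + 1 then (fun r => A r i) else 0)
        = (fun i : ℕ => if i < j + 1 then a i else 0) i := by
      intro i
      simp only
      split_ifs
      · rw [ha]
      · simp
    rw [Finset.sum_congr rfl fun i _ => h2 i,
      Fin.sum_univ_eq_sum_range (fun i : ℕ => if i < (j:ℕ) + 1 then a i else 0),
      ← Finset.sum_filter]
    show ∑ i ∈ Finset.range ((j:ℕ)+1), a i = _
    congr 1
    ext i
    have := j.isLt
    simp
    omega
  have hsι : ∀ j, ∃ v, s j = ExteriorAlgebra.ι R v := fun j =>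
    ⟨∑ i ∈ Finset.range (j+1), (if h : i < n then fun r => A r ⟨i, h⟩ else 0), by
      rw [map_sum]⟩
  have h0 : ∀ j, s j * b j * s j = 0 := by
    intro j
    obtain ⟨v, hv⟩ := hsι j
    have h1 := ExteriorAlgebra.ι_add_mul_swap (R := R) v (if h : j < n then fun r => B r ⟨j, h⟩ else 0)
    have h2 : s j * b j = - (b j * s j) := by
      rw [hv]; exact eq_neg_of_add_eq_zero_left h1
    rw [h2, neg_mul, mul_assoc, hv, ExteriorAlgebra.ι_sq_zero, mul_zero, neg_zero]
  have hP := sum_chain (fun _ => 0) (fun _ j => s j * b j) n (fun _ => by simp) k n le_rfl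
  have hQ := sum_chain (fun c => c % 2) (fun c j => if c % 2 = 0 then a j else b j) n
    (fun L => by omega) (2*k) n le_rfl
  rw [chain_pq a b s (fun _ => rfl) h0, ← hQ] at hP
  have h := congrArg (detFun R (2*k)) hP
  rw [map_sum, map_sum] at h
  refine Eq.trans (Eq.trans ?_ h) ?_
  · refine Finset.sum_congr ?_ fun f _ => ?_
    · ext f
      simp only [Finset.mem_filter, Finset.mem_univ, true_and, Fin.is_lt, implies_true, and_true,
        add_zero]
      constructor
      · intro h s t hst
        exact h (show (s:ℕ) < t by omega)
      · intro h
        cases k with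
        | zero => intro i; exact i.elim0
        | succ k =>
          rw [Fin.strictMono_iff_lt_succ]
          intro i
          exact h _ _ (by simp)
    · rw [← detFun_prod]
      congr 1
      let u : ℕ → ExteriorAlgebra R (Fin (2*k) → R) := fun c =>
        if h : c < 2*k then ExteriorAlgebra.ι R (fun r => sbMat S B f r ⟨c, h⟩) else 0
      have hu : ∀ c : Fin (2*k), ExteriorAlgebra.ι R (fun r => sbMat S B f r c) = u c := by
        intro c; simp [u]
      simp only [hu]
      rw [prod_pairs]
      congr 2
      funext i
      have i1 : 2 * (i:ℕ) < 2 * k := by have := i.isLt; omega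
      have i2 : 2 * (i:ℕ) + 1 < 2 * k := by have := i.isLt; omega
      simp only [u, dif_pos i1, dif_pos i2, pairE_zero, pairE_one, sbMat_zero, sbMat_one, hs, hb]
  · refine Finset.sum_congr ?_ fun d _ => ?_
    · ext d
      simp only [Finset.mem_filter, Finset.mem_univ, true_and, Fin.is_lt, implies_true, and_true]
      refine forall_congr' fun s => forall_congr' fun t => forall_congr' fun hst => ?_
      simp only [Fin.le_def, Fin.lt_def]
      omega
    · rw [← detFun_prod]
      congr 3
      funext c
      simp only [Matrix.of_apply, ha, hb]
      split_ifs <;> rfl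

/-- Asymmetric extension of Okada's minor summation formula (second version):
for `m = 2k` even,
`Σ_{1≤i_1≤j_1<i_2≤j_2<⋯<i_{m/2}≤j_{m/2}≤n} det(A^{i_1}B^{j_1}⋯A^{i_{m/2}}B^{j_{m/2}})
= Pf(A·(U_n+Id_n)·Bᵗ − B·(U_nᵗ+Id_n)·Aᵗ)`.
Each summand is indexed by the sequence `d` of the `m` column indices
`i_1, j_1, i_2, j_2, …` (so `d_s ≤ d_{s+1}` for even positions `s` and
`d_s < d_{s+1}` for odd positions `s`, 0-based; the columns at even positions are
taken from `A`, those at odd positions from `B`). -/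
theorem sum_det_eq_pf_upperTri_add_id {R : Type*} [CommRing R] (k n : ℕ)
    (hk : 0 < k) (hn : 0 < n) (A B : Matrix (Fin (2*k)) (Fin n) R) :
    (∑ d ∈ Finset.univ.filter (fun d : Fin (2*k) → Fin n =>
        ∀ s t : Fin (2*k), (s:ℕ) + 1 = (t:ℕ) →
          ((s:ℕ) % 2 = 0 → d s ≤ d t) ∧ ((s:ℕ) % 2 = 1 → d s < d t)),
      (Matrix.of fun r c : Fin (2*k) =>
        if (c:ℕ) % 2 = 0 then A r (d c) else B r (d c)).det)
      = pfaffian (A * (upperTri R n + 1) * Bᵀ - B * ((upperTri R n)ᵀ + 1) * Aᵀ) := by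
  have h1 : B * ((upperTri R n)ᵀ + 1) * Aᵀ = B * (A * (upperTri R n + 1))ᵀ := by
    rw [Matrix.transpose_mul, Matrix.transpose_add, Matrix.transpose_one, Matrix.mul_assoc]
  rw [h1, pf_general]
  symm
  apply sum_strictMono_eq
  intro r j
  rw [Matrix.mul_apply]
  refine Finset.sum_congr rfl fun i _ => ?_
  rw [Matrix.add_apply, upperTri, Matrix.of_apply, Matrix.one_apply]
  rcases lt_trichotomy i j with h | h | h
  · simp [h, h.le, h.ne]
  · simp [h]
  · simp [h.not_gt, h.not_ge, h.ne']
end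

section
/- Let m and n be positive integers with m even. Let R be a commutative ring and let (h_k(x))_{k∈ℤ} and (h_k(y))_{k∈ℤ} be two sequences in R with h_k(x) = h_k(y) = 0 for k < 0 and h_0(x) = h_0(y) = 1 (for instance, complete homogeneous symmetric functions in variable sets x and y). Then Σ_{R∪S=[m], R∩S=∅, |R|=|S|=m/2} (−1)^{Σ_{r∈R}(r−1)} · Σ_{I,J⊆[n], |I|=|J|=m/2, λ(J)/λ(I) a horizontal strip} s_{λ(I)/λ(R)}(x) · s_{λ(J)/λ(S)}(y) = Pf( ( Σ_{1≤k≤l≤n} ( h_{k−i}(x)·h_{l−j}(y) − h_{l−i}(y)·h_{k−j}(x) ) )_{1≤i,j≤m} ). -/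
open Matrix

/-- Strictly increasing functions `Fin k → Fin n`; these encode the `k`-element
subsets of `{1,…,n}` listed in increasing order. -/
def incrFuns (k n : ℕ) : Finset (Fin k → Fin n) :=
  Finset.univ.filter fun f => ∀ a b : Fin k, a < b → f a < f b

/-- For a `k`-element subset `I = {i_1 < … < i_k}` of `{1,…,n}` (encoded by a strictly
increasing `f : Fin k → Fin n`, 0-based), the partition
`λ(I) = (i_k − k, …, i_2 − 2, i_1 − 1)`, listed as `λ(I)_1, λ(I)_2, …` (0-based). -/
def lamFun {n k : ℕ} (f : Fin k → Fin n) : Fin k → ℤ :=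
  fun t => ((f ⟨k - 1 - (t:ℕ), by have := t.isLt; omega⟩ : Fin n) : ℤ)
    - ((k : ℤ) - 1 - (t : ℤ))

/-- The partition `λ(s)` for a `k`-element subset `s` of `{1,…,N}` given as a
`Finset` together with a proof of its cardinality. -/
def lamSet {N k : ℕ} (s : Finset (Fin N)) (h : s.card = k) : Fin k → ℤ :=
  fun t => ((s.orderEmbOfFin h ⟨k - 1 - (t:ℕ), by have := t.isLt; omega⟩ : Fin N) : ℤ)
    - ((k : ℤ) - 1 - (t : ℤ))

/-- The skew Schur function `s_{λ/μ} = det(h_{λ_j − j − μ_i + i})_{1≤i,j≤k}`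
(Jacobi–Trudi), where `h : ℤ → α` is the sequence of complete homogeneous symmetric
functions. -/
def skewSchur {α : Type*} [CommRing α] {k : ℕ} (h : ℤ → α) (lam mu : Fin k → ℤ) : α :=
  (Matrix.of fun i j : Fin k => h (lam j - (j : ℤ) - mu i + (i : ℤ))).det

namespace CTS

lemma sum_sort {α β : Type*} [AddCommMonoid α] [LinearOrder β] {k : ℕ} (f : Fin k → β)
    (hf : Function.Injective f) (c : α) :
    ∑ π : Equiv.Perm (Fin k), (if ∀ a b : Fin k, a < b → f (π a) < f (π b) then c else 0) = c := by
  rw [Finset.sum_eq_single (Tuple.sort f)]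
  · rw [if_pos]
    intro a b hab
    have h1 : StrictMono (f ∘ Tuple.sort f) :=
      (Tuple.monotone_sort f).strictMono_of_injective (hf.comp (Tuple.sort f).injective)
    exact h1 hab
  · intro π _ hne
    rw [if_neg]
    intro h
    apply hne
    have h1 : StrictMono (f ∘ π) := fun a b hab => h a b hab
    have h2 := Tuple.unique_monotone h1.monotone (Tuple.monotone_sort f)
    ext i
    have := hf (congrFun h2 i)
    rw [this]
  · simp

lemma cauchy_binet {α : Type*} [CommRing α] {k n : ℕ} (X : Matrix (Fin k) (Fin n) α)
    (Y : Matrix (Fin n) (Fin k) α) :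
    (X * Y).det = ∑ f ∈ incrFuns k n, (X.submatrix id f).det * (Y.submatrix f id).det := by
  have h1 : (X * Y).det = ∑ f : Fin k → Fin n, (∏ i, X i (f i)) * (Y.submatrix f id).det := by
    have h0 : X * Y = fun i => ∑ a : Fin n, X i a • Y a := by
      ext i j
      simp [Matrix.mul_apply, Finset.sum_apply]
    rw [h0]
    have := (Matrix.detRowAlternating (n := Fin k) (R := α)).toMultilinearMap.map_sum
      (fun i (a : Fin n) => X i a • Y a)
    refine Eq.trans this ?_
    refine Finset.sum_congr rfl fun f _ => ?_
    refine Eq.trans (MultilinearMap.map_smul_univ _ _ _) ?_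
    rfl
  rw [h1]
  have h2 : ∀ f : Fin k → Fin n, (∏ i, X i (f i)) * (Y.submatrix f id).det =
      ∑ π : Equiv.Perm (Fin k), if ∀ a b : Fin k, a < b → f (π a) < f (π b) then
        (∏ i, X i (f i)) * (Y.submatrix f id).det else 0 := by
    intro f
    by_cases hf : Function.Injective f
    · rw [sum_sort f hf]
    · have : (Y.submatrix f id).det = 0 := by
        simp only [Function.Injective, not_forall] at hf
        obtain ⟨a, b, hab, hne⟩ := hf
        exact Matrix.det_zero_of_row_eq hne (by ext j; simp [hab])
      simp [this]
  rw [Finset.sum_congr rfl fun f _ => h2 f, Finset.sum_comm]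
  have h3 : ∀ π : Equiv.Perm (Fin k),
      (∑ f : Fin k → Fin n, if ∀ a b : Fin k, a < b → f (π a) < f (π b) then
        (∏ i, X i (f i)) * (Y.submatrix f id).det else 0) =
      ∑ f ∈ incrFuns k n, ((Equiv.Perm.sign π : ℤ) : α) * (∏ i, X (π i) (f i)) *
        (Y.submatrix f id).det := by
    intro π
    rw [incrFuns, Finset.sum_filter]
    refine Fintype.sum_equiv (Equiv.arrowCongr π.symm (Equiv.refl _)) _ _ fun f => ?_
    have e1 : ∀ i, (Equiv.arrowCongr π.symm (Equiv.refl (Fin n))) f i = f (π i) := fun i => rfl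
    simp only [e1]
    refine if_congr Iff.rfl ?_ rfl
    have e2 : (Y.submatrix ((Equiv.arrowCongr π.symm (Equiv.refl (Fin n))) f) id) =
      (Y.submatrix f id).submatrix π id := rfl
    rw [e2, Matrix.det_permute]
    rw [← Equiv.prod_comp π (fun i => X i (f i))]
    have : ((Equiv.Perm.sign π : ℤ) : α) * ((Equiv.Perm.sign π : ℤ) : α) = 1 := by
      rw [← Int.cast_mul, ← Units.val_mul, Int.units_mul_self]; simp
    linear_combination (-(∏ i, X (π i) (f (π i))) * (Y.submatrix f id).det) * this
  rw [Finset.sum_congr rfl fun π _ => h3 π, Finset.sum_comm]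
  refine Finset.sum_congr rfl fun f _ => ?_
  rw [← Finset.sum_mul, Matrix.det_apply' (X.submatrix id f)]
  rfl

lemma det_interlace {α : Type*} [CommRing α] {k n : ℕ} (f g : Fin k → Fin n)
    (hf : StrictMono f) (hg : StrictMono g) :
    (Matrix.of fun i j : Fin k => if f i ≤ g j then (1 : α) else 0).det =
      if (∀ t, f t ≤ g t) ∧ (∀ s t : Fin k, (s : ℕ) + 1 = t → g s < f t) then 1 else 0 := by
  set A := (Matrix.of fun i j : Fin k => if f i ≤ g j then (1 : α) else 0) with hA
  split_ifs with h
  · rw [Matrix.det_of_isUpperTriangular]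
    · simp [hA, h.1]
    · intro i j hij
      have hij : j < i := hij
      have h1 := h.2 j ⟨j + 1, by omega⟩ rfl
      have h2 : f ⟨j + 1, by omega⟩ ≤ f i := hf.monotone (by rw [Fin.le_def]; simp; omega)
      simp [hA, h1.trans_le h2]
  · by_contra hdet
    apply h
    -- first row consists of nonzero entries
    have hk : ∀ j : Fin k, ∃ i, f i ≤ g j := by
      intro j
      by_contra hc
      push Not at hc
      exact hdet (Matrix.det_eq_zero_of_column_eq_zero j fun i => by simp [hA, hc i])
    let c : Fin k → Fin k := fun j =>
      (Finset.univ.filter fun i => f i ≤ g j).max' (by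
        obtain ⟨i, hi⟩ := hk j; exact ⟨i, by simpa using hi⟩)
    have hc : ∀ i j, f i ≤ g j ↔ i ≤ c j := by
      intro i j
      constructor
      · intro h; exact Finset.le_max' _ _ (by simpa using h)
      · intro h
        have := Finset.max'_mem (Finset.univ.filter fun i => f i ≤ g j) (by
          obtain ⟨i, hi⟩ := hk j; exact ⟨i, by simpa using hi⟩)
        exact (hf.monotone h).trans (by simpa using this)
    have hcm : Monotone c := by
      intro a b hab
      rw [← hc]
      exact ((hc _ _).2 le_rfl).trans (hg.monotone hab)
    have hci : Function.Injective c := by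
      intro a b hab
      by_contra hne
      exact hdet (Matrix.det_zero_of_column_eq hne fun i => by simp [hA, hc, hab])
    have hcs : StrictMono c := hcm.strictMono_of_injective hci
    have hid : ∀ j, c j = j := fun j => le_antisymm (hcs.apply_le) (hcs.le_apply)
    refine ⟨fun t => by rw [hc, hid], fun s t hst => ?_⟩
    rw [← not_le, hc, hid, not_le, Fin.lt_def]
    omega

end CTS
namespace CTS

def eS (k : ℕ) : Fin k × Bool ≃ Fin (2 * k) where
  toFun x := if x.2 then ⟨2 * (x.1 : ℕ) + 1, by have := x.1.isLt; omega⟩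
    else ⟨2 * (x.1 : ℕ), by have := x.1.isLt; omega⟩
  invFun y := (⟨(y : ℕ) / 2, by have := y.isLt; omega⟩, decide ((y : ℕ) % 2 = 1))
  left_inv := by
    rintro ⟨i, b⟩
    cases b
    · simp
    · simp only [if_true, Prod.mk.injEq, Fin.ext_iff, decide_eq_true_eq]; omega
  right_inv := by
    intro y
    by_cases h : (y : ℕ) % 2 = 1
    · simp [h]; ext; simp; omega
    · simp [h]; ext; simp; omega

lemma eS_false {k : ℕ} (i : Fin k) :
    eS k (i, false) = ⟨2 * (i : ℕ), by have := i.isLt; omega⟩ := rfl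
lemma eS_true {k : ℕ} (i : Fin k) :
    eS k (i, true) = ⟨2 * (i : ℕ) + 1, by have := i.isLt; omega⟩ := rfl

def blk {k : ℕ} (π : Equiv.Perm (Fin k)) : Equiv.Perm (Fin (2 * k)) :=
  (eS k).permCongr (Equiv.prodCongrLeft fun _ => π)

lemma blk_apply {k : ℕ} (π : Equiv.Perm (Fin k)) (i : Fin k) (b : Bool) :
    blk π (eS k (i, b)) = eS k (π i, b) := by
  simp [blk, Equiv.permCongr_apply]

lemma sign_blk {k : ℕ} (π : Equiv.Perm (Fin k)) : Equiv.Perm.sign (blk π) = 1 := by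
  rw [blk, Equiv.Perm.sign_permCongr, Equiv.Perm.sign_prodCongrLeft]
  simp

def fl (b : Bool) : Equiv.Perm Bool := if b then Equiv.swap false true else 1

lemma fl_fl (b c : Bool) : fl b (fl b c) = c := by
  cases b <;> cases c <;> rfl

def flp {k : ℕ} (ε : Fin k → Bool) : Equiv.Perm (Fin (2 * k)) :=
  (eS k).permCongr (Equiv.prodCongrRight fun i => fl (ε i))

lemma flp_apply {k : ℕ} (ε : Fin k → Bool) (i : Fin k) (b : Bool) :
    flp ε (eS k (i, b)) = eS k (i, fl (ε i) b) := by
  simp [flp, Equiv.permCongr_apply]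

lemma sign_flp {k : ℕ} (ε : Fin k → Bool) :
    Equiv.Perm.sign (flp ε) = ∏ i, Equiv.Perm.sign (fl (ε i)) := by
  rw [flp, Equiv.Perm.sign_permCongr, Equiv.Perm.sign_prodCongrRight]

/-- the signed term -/
def term {α : Type*} [CommRing α] {k : ℕ} (Z : Matrix (Fin (2 * k)) (Fin (2 * k)) α)
    (σ : Equiv.Perm (Fin (2 * k))) : α :=
  ((Equiv.Perm.sign σ : ℤ) : α) * ∏ i : Fin k, Z (σ (eS k (i, false))) (σ (eS k (i, true)))

lemma term_blk {α : Type*} [CommRing α] {k : ℕ} (Z : Matrix (Fin (2 * k)) (Fin (2 * k)) α)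
    (σ : Equiv.Perm (Fin (2 * k))) (π : Equiv.Perm (Fin k)) :
    term Z (σ * blk π) = term Z σ := by
  simp only [term, Equiv.Perm.sign_mul, sign_blk, mul_one, Equiv.Perm.mul_apply, blk_apply]
  rw [Equiv.prod_comp π (fun i => Z (σ (eS k (i, false))) (σ (eS k (i, true))))]

lemma key_change {α : Type*} [CommRing α] {k : ℕ} (F : Equiv.Perm (Fin (2 * k)) → α)
    (hF : ∀ σ (π : Equiv.Perm (Fin k)), F (σ * blk π) = F σ)
    (T U : Equiv.Perm (Fin (2 * k)) → Fin k → Fin (2 * k))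
    (hT : ∀ σ, Function.Injective (T σ)) (hU : ∀ σ, Function.Injective (U σ))
    (hTb : ∀ σ π i, T (σ * blk π) i = T σ (π i)) (hUb : ∀ σ π i, U (σ * blk π) i = U σ (π i)) :
    (∑ σ, if ∀ a b : Fin k, a < b → T σ a < T σ b then F σ else 0) =
    (∑ σ, if ∀ a b : Fin k, a < b → U σ a < U σ b then F σ else 0) := by
  have h1 : ∀ σ, (if ∀ a b : Fin k, a < b → T σ a < T σ b then F σ else 0) =
      ∑ π : Equiv.Perm (Fin k), if ∀ a b : Fin k, a < b → U σ (π a) < U σ (π b) then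
        (if ∀ a b : Fin k, a < b → T σ a < T σ b then F σ else 0) else 0 :=
    fun σ => (sum_sort (U σ) (hU σ) _).symm
  have h2 : ∀ σ, (if ∀ a b : Fin k, a < b → U σ a < U σ b then F σ else 0) =
      ∑ π : Equiv.Perm (Fin k), if ∀ a b : Fin k, a < b → T σ (π a) < T σ (π b) then
        (if ∀ a b : Fin k, a < b → U σ a < U σ b then F σ else 0) else 0 :=
    fun σ => (sum_sort (T σ) (hT σ) _).symm
  rw [Finset.sum_congr rfl fun σ _ => h1 σ, Finset.sum_congr rfl fun σ _ => h2 σ,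
    Finset.sum_comm, Finset.sum_comm (s := (Finset.univ : Finset (Equiv.Perm (Fin (2 * k)))))]
  refine Fintype.sum_equiv (Equiv.inv _) _ _ fun π => ?_
  refine Fintype.sum_equiv (Equiv.mulRight (blk π)) _ _ fun σ => ?_
  have hpi : ∀ a, π (π⁻¹ a) = a := fun a => π.apply_symm_apply a
  simp only [Equiv.coe_mulRight, Equiv.inv_apply, hTb, hUb, hF, hpi]
  split_ifs <;> rfl

lemma sum_flip {α : Type*} [CommRing α] {k : ℕ} (σ : Equiv.Perm (Fin (2 * k))) (c : α) :
    (∑ ε : Fin k → Bool, if ∀ i, σ (eS k (i, fl (ε i) false)) < σ (eS k (i, fl (ε i) true))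
      then c else 0) = c := by
  have h : ∀ ε : Fin k → Bool,
      (if ∀ i, σ (eS k (i, fl (ε i) false)) < σ (eS k (i, fl (ε i) true)) then c else 0) =
      (∏ i, if σ (eS k (i, fl (ε i) false)) < σ (eS k (i, fl (ε i) true)) then 1 else 0) * c := by
    intro ε
    rw [Finset.prod_ite_zero]
    simp
  rw [Finset.sum_congr rfl fun ε _ => h ε, ← Finset.sum_mul]
  have h2 := Finset.prod_univ_sum (fun _ : Fin k => (Finset.univ : Finset Bool))
    (fun i b => if σ (eS k (i, fl b false)) < σ (eS k (i, fl b true)) then (1 : α) else 0)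
  rw [Fintype.piFinset_univ] at h2
  rw [← h2, Finset.prod_eq_one, one_mul]
  intro i _
  have hne : σ (eS k (i, false)) ≠ σ (eS k (i, true)) := by simp
  rcases lt_or_gt_of_ne hne with h | h
  · simp [fl, h, h.le]
  · simp [fl, h, h.le]

def minkey {k : ℕ} (σ : Equiv.Perm (Fin (2 * k))) (i : Fin k) : Fin (2 * k) :=
  min (σ (eS k (i, false))) (σ (eS k (i, true)))

lemma minkey_flp {k : ℕ} (σ : Equiv.Perm (Fin (2 * k))) (ε : Fin k → Bool) (i : Fin k) :
    minkey (σ * flp ε) i = minkey σ i := by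
  simp only [minkey, Equiv.Perm.mul_apply, flp_apply]
  cases ε i
  · rfl
  · rw [min_comm]; rfl

lemma minkey_inj {k : ℕ} (σ : Equiv.Perm (Fin (2 * k))) : Function.Injective (minkey σ) := by
  intro i j h
  simp only [minkey] at h
  rcases min_choice (σ (eS k (i, false))) (σ (eS k (i, true))) with h1 | h1 <;>
  rcases min_choice (σ (eS k (j, false))) (σ (eS k (j, true))) with h2 | h2 <;>
  · rw [h1, h2] at h
    simpa using h

lemma pfaffian_eq {α : Type*} [CommRing α] {k : ℕ} (Z : Matrix (Fin (2 * k)) (Fin (2 * k)) α) :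
    pfaffian (Matrix.of fun i j => Z i j - Z j i) =
      ∑ σ, if ∀ a b : Fin k, a < b → σ (eS k (a, false)) < σ (eS k (b, false))
        then term Z σ else 0 := by
  rw [key_change (term Z) (term_blk Z) (fun σ i => σ (eS k (i, false))) minkey
    (fun σ i j h => by simpa using h) minkey_inj
    (fun σ π i => by simp [blk_apply]) (fun σ π i => by simp [minkey, blk_apply])]
  have h1 : ∀ σ, (if ∀ a b : Fin k, a < b → minkey σ a < minkey σ b then term Z σ else 0) = _ :=
    fun σ => (sum_flip σ _).symm
  rw [Finset.sum_congr rfl fun σ _ => h1 σ, Finset.sum_comm]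
  have h2 : ∀ ε : Fin k → Bool,
      (∑ σ : Equiv.Perm (Fin (2 * k)),
        if ∀ i, σ (eS k (i, fl (ε i) false)) < σ (eS k (i, fl (ε i) true)) then
        (if ∀ a b : Fin k, a < b → minkey σ a < minkey σ b then term Z σ else 0) else 0) =
      ∑ σ : Equiv.Perm (Fin (2 * k)),
        if ∀ i, σ (eS k (i, false)) < σ (eS k (i, true)) then
        (if ∀ a b : Fin k, a < b → minkey σ a < minkey σ b then term Z (σ * flp ε) else 0)
        else 0 := by
    intro ε
    symm
    refine Fintype.sum_equiv (Equiv.mulRight (flp ε)) _ _ fun σ => ?_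
    simp only [Equiv.coe_mulRight, minkey_flp, Equiv.Perm.mul_apply, flp_apply, fl_fl]
  rw [Finset.sum_congr rfl fun ε _ => h2 ε, Finset.sum_comm]
  rw [pfaffian, Finset.sum_filter]
  refine Finset.sum_congr rfl fun σ _ => ?_
  refine Eq.trans (b := if (∀ i, σ (eS k (i, false)) < σ (eS k (i, true))) ∧
    (∀ a b : Fin k, a < b → σ (eS k (a, false)) < σ (eS k (b, false))) then
    ((Equiv.Perm.sign σ : ℤ) : α) * ∏ i : Fin k, (Z (σ (eS k (i, false))) (σ (eS k (i, true))) -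
      Z (σ (eS k (i, true))) (σ (eS k (i, false)))) else 0) (if_congr Iff.rfl rfl rfl) ?_
  by_cases hO : ∀ i, σ (eS k (i, false)) < σ (eS k (i, true))
  · have hm : ∀ i, minkey σ i = σ (eS k (i, false)) := fun i => min_eq_left (hO i).le
    simp only [hm]
    by_cases hM : ∀ a b : Fin k, a < b → σ (eS k (a, false)) < σ (eS k (b, false))
    · rw [if_pos ⟨hO, hM⟩]
      simp only [if_pos hO, if_pos hM]
      simp only [term, Equiv.Perm.sign_mul, sign_flp, Equiv.Perm.mul_apply, flp_apply]
      simp only [Units.val_mul, Units.coe_prod, Int.cast_mul, Int.cast_prod, mul_assoc,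
        ← Finset.mul_sum, ← Finset.prod_mul_distrib]
      congr 1
      have h2 := Finset.prod_univ_sum (fun _ : Fin k => (Finset.univ : Finset Bool))
        (fun i b => ((Equiv.Perm.sign (fl b) : ℤ) : α) *
          Z (σ (eS k (i, fl b false))) (σ (eS k (i, fl b true))))
      rw [Fintype.piFinset_univ] at h2
      rw [← h2]
      refine Finset.prod_congr rfl fun i _ => ?_
      simp [fl]
      ring
    · rw [if_neg (fun h => hM h.2)]
      simp [if_neg hM]
  · rw [if_neg (fun h => hO h.1)]
    simp [if_neg hO]

end CTS
namespace CTS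

def es (k : ℕ) : Fin k ⊕ Fin k ≃ Fin (2 * k) :=
  (Equiv.boolProdEquivSum (Fin k)).symm.trans ((Equiv.prodComm _ _).trans (eS k))

lemma es_inl {k : ℕ} (i : Fin k) : es k (Sum.inl i) = eS k (i, false) := rfl
lemma es_inr {k : ℕ} (i : Fin k) : es k (Sum.inr i) = eS k (i, true) := rfl

lemma sign_eq_prod_sum {k : ℕ} (g : Fin k ⊕ Fin k ≃ Fin (2 * k)) :
    Equiv.Perm.sign ((es k).symm.trans g) =
      ∏ u, ∏ v, if es k u < es k v then (if g u < g v then 1 else -1) else 1 := by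
  rw [Equiv.Perm.sign_eq_prod_prod_Ioi]
  symm
  refine Fintype.prod_equiv (es k) _ _ fun u => ?_
  rw [← Finset.filter_lt_eq_Ioi, Finset.prod_filter]
  refine Fintype.prod_equiv (es k) _ _ fun v => ?_
  simp

lemma sign_shuffle {k : ℕ} (s : Finset (Fin (2 * k))) (h1 : s.card = k) (h2 : sᶜ.card = k) :
    Equiv.Perm.sign ((es k).symm.trans (finSumEquivOfFinset h1 h2)) =
      (-1) ^ (∑ r ∈ s, (r : ℕ)) := by
  rw [sign_eq_prod_sum]
  set g := finSumEquivOfFinset h1 h2 with hg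
  have gl : ∀ i j, g (Sum.inl i) < g (Sum.inl j) ↔ i < j := by
    intro i j; simp [hg]
  have gr : ∀ i j, g (Sum.inr i) < g (Sum.inr j) ↔ i < j := by
    intro i j; simp [hg]
  have ell : ∀ i j, es k (Sum.inl i) < es k (Sum.inl j) ↔ i < j := by
    intro i j; simp only [es_inl, eS_false, Fin.lt_def]; omega
  have err : ∀ i j, es k (Sum.inr i) < es k (Sum.inr j) ↔ i < j := by
    intro i j; simp only [es_inr, eS_true, Fin.lt_def]; omega
  have elr : ∀ i j, es k (Sum.inl i) < es k (Sum.inr j) ↔ ¬ j < i := by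
    intro i j; simp only [es_inl, es_inr, eS_true, eS_false, Fin.lt_def]; omega
  have erl : ∀ i j, es k (Sum.inr i) < es k (Sum.inl j) ↔ i < j := by
    intro i j; simp only [es_inl, es_inr, eS_true, eS_false, Fin.lt_def]; omega
  have hcount : ∀ x : Fin (2 * k), (∏ u, if g u < x then (-1 : ℤˣ) else 1) = (-1) ^ (x : ℕ) := by
    intro x
    rw [Equiv.prod_comp g (fun y => if y < x then (-1 : ℤˣ) else 1), ← Finset.prod_filter,
      Finset.prod_const, Finset.filter_gt_eq_Iio, Fin.card_Iio]
  have hs : ∑ r ∈ s, (r : ℕ) = ∑ i, (g (Sum.inl i) : ℕ) := by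
    have : s = Finset.univ.map (s.orderEmbOfFin h1).toEmbedding := by simp
    conv_lhs => rw [this]
    rw [Finset.sum_map]
    simp [hg]
  rw [hs, ← Finset.prod_pow_eq_pow_sum, Finset.prod_congr rfl fun i _ => (hcount _).symm]
  simp only [Fintype.prod_sum_type, gl, gr, ell, err, elr, erl]
  have t1 : ∀ a b : Fin k, (if a < b then if a < b then (1 : ℤˣ) else -1 else 1) = 1 := by
    intro a b; split_ifs <;> rfl
  simp only [t1, Finset.prod_const_one, one_mul, mul_one]
  rw [Finset.prod_comm (f := fun a b : Fin k =>
    if a < b then if g (Sum.inr a) < g (Sum.inl b) then (1 : ℤˣ) else -1 else 1),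
    ← Finset.prod_mul_distrib]
  refine Finset.prod_congr rfl fun i _ => ?_
  rw [← Finset.prod_mul_distrib, ← Finset.prod_mul_distrib]
  refine Finset.prod_congr rfl fun j _ => ?_
  have hne : g (Sum.inl i) ≠ g (Sum.inr j) := by simp
  rcases lt_or_gt_of_ne hne with h | h <;> by_cases hji : j < i <;> simp [h, h.le, hji, not_lt_of_gt h]

lemma shuffle_sum {α : Type*} [CommRing α] {k : ℕ} (Z : Matrix (Fin (2 * k)) (Fin (2 * k)) α) :
    (∑ σ, if ∀ a b : Fin k, a < b → σ (eS k (a, false)) < σ (eS k (b, false))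
        then term Z σ else 0) =
    ∑ s : Finset (Fin (2 * k)), if h : s.card = k ∧ sᶜ.card = k then
      (-1 : α) ^ (∑ r ∈ s, (r : ℕ)) *
        (Z.submatrix (s.orderEmbOfFin h.1) (sᶜ.orderEmbOfFin h.2)).det else 0 := by
  rw [← Finset.sum_filter]
  rw [← Finset.sum_fiberwise _ (fun σ : Equiv.Perm (Fin (2 * k)) =>
    Finset.univ.image (fun i : Fin k => σ (eS k (i, false))))]
  refine Finset.sum_congr rfl fun s _ => ?_
  split_ifs with h
  · obtain ⟨h1, h2⟩ := h
    set g := finSumEquivOfFinset h1 h2 with hg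
    have gl : ∀ i, g (Sum.inl i) = s.orderEmbOfFin h1 i := by intro i; simp [hg]
    have gr : ∀ i, g (Sum.inr i) = sᶜ.orderEmbOfFin h2 i := by intro i; simp [hg]
    let Φ : Equiv.Perm (Fin k) → Equiv.Perm (Fin (2 * k)) := fun π =>
      (es k).symm.trans ((Equiv.sumCongr (Equiv.refl _) π).trans g)
    have Φf : ∀ π i, Φ π (eS k (i, false)) = s.orderEmbOfFin h1 i := by
      intro π i
      simp only [Φ, ← es_inl, Equiv.trans_apply, Equiv.symm_apply_apply]
      exact gl i
    have Φt : ∀ π i, Φ π (eS k (i, true)) = sᶜ.orderEmbOfFin h2 (π i) := by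
      intro π i
      simp only [Φ, ← es_inr, Equiv.trans_apply, Equiv.symm_apply_apply]
      exact gr (π i)
    have Φs : ∀ π, Equiv.Perm.sign (Φ π) = (-1) ^ (∑ r ∈ s, (r : ℕ)) * Equiv.Perm.sign π := by
      intro π
      have : Φ π = (((es k).symm.trans (Equiv.Perm.sumCongr 1 π)).trans (es k)).trans
          ((es k).symm.trans g) := by
        ext x; simp [Φ]
      rw [this, Equiv.Perm.sign_trans, sign_shuffle s h1 h2,
        Equiv.Perm.sign_symm_trans_trans, Equiv.Perm.sign_sumCongr]
      simp
    rw [← Matrix.det_transpose, Matrix.det_apply', Finset.mul_sum]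
    symm
    refine Finset.sum_bij (fun π _ => Φ π) ?_ ?_ ?_ ?_
    · intro π _
      simp only [Finset.mem_filter, Finset.mem_univ, true_and, Φf]
      refine ⟨fun a b hab => by simpa using hab, ?_⟩
      have : s = Finset.univ.map (s.orderEmbOfFin h1).toEmbedding := by simp
      conv_rhs => rw [this]
      rw [Finset.map_eq_image]; rfl
    · intro π _ π' _ hh
      ext i
      have := congrArg (fun σ : Equiv.Perm (Fin (2 * k)) => σ (eS k (i, true))) hh
      simp only [Φt] at this
      exact congrArg _ ((sᶜ.orderEmbOfFin h2).injective this)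
    · intro σ hσ
      simp only [Finset.mem_filter, Finset.mem_univ, true_and] at hσ
      obtain ⟨hm, him⟩ := hσ
      have hl : ∀ i, σ (eS k (i, false)) = s.orderEmbOfFin h1 i := by
        have := Finset.orderEmbOfFin_unique h1 (f := fun i => σ (eS k (i, false)))
          (fun x => by rw [← him]; exact Finset.mem_image_of_mem _ (Finset.mem_univ _))
          (fun a b hab => hm a b hab)
        exact congrFun this
      let τ : Equiv.Perm (Fin k ⊕ Fin k) := (es k).trans (σ.trans g.symm)
      have hτl : ∀ i, τ (Sum.inl i) = Sum.inl i := by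
        intro i
        simp only [τ, Equiv.trans_apply, es_inl, hl, ← gl, Equiv.symm_apply_apply]
      have hτ : τ ∈ (Equiv.Perm.sumCongrHom (Fin k) (Fin k)).range := by
        apply Equiv.Perm.mem_sumCongrHom_range_of_perm_mapsTo_inl
        rintro _ ⟨i, rfl⟩
        exact ⟨i, (hτl i).symm⟩
      obtain ⟨⟨π1, π⟩, hπ⟩ := hτ
      refine ⟨π, Finset.mem_univ _, ?_⟩
      ext x
      obtain ⟨u, rfl⟩ := (es k).surjective x
      rcases u with i | i
      · rw [es_inl, Φf, hl]
      · rw [es_inr, Φt, ← gr, ← es_inr]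
        have : τ (Sum.inr i) = Sum.inr (π i) := by rw [← hπ]; rfl
        rw [← this]
        simp [τ]
    · intro π _
      simp only [term, Φf, Φt, Φs, Matrix.transpose_apply, Matrix.submatrix_apply]
      push_cast
      ring
  · apply Finset.sum_eq_zero
    intro σ hσ
    exfalso
    apply h
    simp only [Finset.mem_filter, Finset.mem_univ, true_and] at hσ
    have h1 : s.card = k := by
      rw [← hσ.2, Finset.card_image_of_injective _ (fun i j hij => by simpa using hij)]
      simp
    refine ⟨h1, ?_⟩
    rw [Finset.card_compl, h1, Fintype.card_fin]; omega

lemma skewSchur_eq {α : Type*} [CommRing α] {k n : ℕ} (h : ℤ → α) (f : Fin k → Fin n)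
    (s : Finset (Fin (2 * k))) (hs : s.card = k) :
    skewSchur h (lamFun f) (lamSet s hs) =
      (Matrix.of fun i j : Fin k => h ((f j : ℤ) - (s.orderEmbOfFin hs i : ℤ))).det := by
  rw [← Matrix.det_submatrix_equiv_self Fin.revPerm, skewSchur]
  congr 1
  ext i j
  simp only [Matrix.of_apply, Matrix.submatrix_apply, lamFun, lamSet, Fin.revPerm_apply]
  have e : ∀ t : Fin k, (⟨k - 1 - (t : ℕ), by have := t.isLt; omega⟩ : Fin k) = t.rev := by
    intro t; ext; simp [Fin.rev]; omega
  rw [e, e]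
  congr 1
  ring

lemma cond_eq {k n : ℕ} (f g : Fin k → Fin n) :
    ((∀ t : Fin k, lamFun f t ≤ lamFun g t) ∧
      (∀ s t : Fin k, (s:ℕ) + 1 = (t:ℕ) → lamFun g t ≤ lamFun f s)) ↔
    ((∀ t, f t ≤ g t) ∧ (∀ s t : Fin k, (s : ℕ) + 1 = t → g s < f t)) := by
  have e : ∀ t : Fin k, (⟨k - 1 - (t : ℕ), by have := t.isLt; omega⟩ : Fin k) = t.rev := by
    intro t; ext; simp [Fin.rev]; omega
  simp only [lamFun, e]
  refine and_congr ?_ ?_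
  · constructor
    · intro h t
      have := h t.rev
      rw [Fin.rev_rev] at this
      rw [Fin.le_def]; omega
    · intro h t
      have := h t.rev
      rw [Fin.le_def] at this; omega
  · constructor
    · intro h s t hst
      have := h t.rev s.rev (by simp only [Fin.val_rev]; omega)
      simp only [Fin.rev_rev, Fin.val_rev] at this
      rw [Fin.lt_def]; omega
    · intro h s t hst
      have := h t.rev s.rev (by simp only [Fin.val_rev]; omega)
      rw [Fin.lt_def] at this; omega

end CTS

/-- A Cauchy-type identity for skew Schur functions: for `m = 2k` even,
`Σ_{R∪S=[m], R∩S=∅, |R|=|S|=k} (−1)^{Σ_{r∈R}(r−1)}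
  Σ_{I,J⊆[n], |I|=|J|=k, λ(J)/λ(I) hor. strip} s_{λ(I)/λ(R)}(x) s_{λ(J)/λ(S)}(y)
= Pf(Σ_{1≤κ≤l≤n} (h_{κ−i}(x) h_{l−j}(y) − h_{l−i}(y) h_{κ−j}(x)))_{1≤i,j≤m}`.
Here the pairs `(R,S)` are parametrised by `R`, with `S = Rᶜ`, and all indices are
0-based (so `(−1)^{Σ_{r∈R}(r−1)}` becomes `(−1)^{Σ_{r∈R} r}`, and `h_{κ−i}` becomes
`hx (κ − i)` with `κ : Fin n`, `i : Fin m` 0-based). -/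
theorem cauchy_type_skew_schur {α : Type*} [CommRing α] (k n : ℕ) (hk : 0 < k) (hn : 0 < n)
    (hx hy : ℤ → α) (hx0 : hx 0 = 1) (hy0 : hy 0 = 1)
    (hxneg : ∀ z : ℤ, z < 0 → hx z = 0) (hyneg : ∀ z : ℤ, z < 0 → hy z = 0) :
    (∑ Rs : Finset (Fin (2*k)),
        if hR : Rs.card = k ∧ Rsᶜ.card = k then
          (-1 : α)^(∑ r ∈ Rs, (r : ℕ)) *
            ∑ fI ∈ incrFuns k n, ∑ fJ ∈ incrFuns k n,
              if (∀ t : Fin k, lamFun fI t ≤ lamFun fJ t) ∧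
                  (∀ s t : Fin k, (s:ℕ) + 1 = (t:ℕ) → lamFun fJ t ≤ lamFun fI s) then
                skewSchur hx (lamFun fI) (lamSet Rs hR.1) *
                  skewSchur hy (lamFun fJ) (lamSet Rsᶜ hR.2)
              else 0
        else 0)
      = pfaffian (Matrix.of fun i j : Fin (2*k) =>
          ∑ a : Fin n, ∑ b : Fin n,
            if a ≤ b then
              hx ((a : ℤ) - (i : ℤ)) * hy ((b : ℤ) - (j : ℤ)) -
                hy ((b : ℤ) - (i : ℤ)) * hx ((a : ℤ) - (j : ℤ))
            else 0) := by
  set X : Matrix (Fin (2*k)) (Fin n) α := Matrix.of fun i a => hx ((a : ℤ) - (i : ℤ)) with hX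
  set Y : Matrix (Fin (2*k)) (Fin n) α := Matrix.of fun i a => hy ((a : ℤ) - (i : ℤ)) with hY
  set A : Matrix (Fin n) (Fin n) α := Matrix.of fun a b => if a ≤ b then 1 else 0 with hA
  have hZ : (Matrix.of fun i j : Fin (2*k) =>
          ∑ a : Fin n, ∑ b : Fin n,
            if a ≤ b then
              hx ((a : ℤ) - (i : ℤ)) * hy ((b : ℤ) - (j : ℤ)) -
                hy ((b : ℤ) - (i : ℤ)) * hx ((a : ℤ) - (j : ℤ))
            else 0) = Matrix.of fun i j => (X * (A * Yᵀ)) i j - (X * (A * Yᵀ)) j i := by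
    ext i j
    simp only [Matrix.of_apply, Matrix.mul_apply, Matrix.transpose_apply, hX, hY, hA,
      Finset.mul_sum, ← Finset.sum_sub_distrib]
    refine Finset.sum_congr rfl fun a _ => Finset.sum_congr rfl fun b _ => ?_
    split_ifs <;> ring
  rw [hZ, CTS.pfaffian_eq, CTS.shuffle_sum]
  refine Finset.sum_congr rfl fun s _ => ?_
  split_ifs with h
  swap
  · rfl
  congr 1
  have hsub : (X * (A * Yᵀ)).submatrix (s.orderEmbOfFin h.1) (sᶜ.orderEmbOfFin h.2) =
      (X.submatrix (s.orderEmbOfFin h.1) id) * (A * Yᵀ.submatrix id (sᶜ.orderEmbOfFin h.2)) := by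
    ext i j; simp [Matrix.mul_apply]
  rw [hsub, CTS.cauchy_binet]
  refine Finset.sum_congr rfl fun f hf => ?_
  have hsub2 : (A * Yᵀ.submatrix id (sᶜ.orderEmbOfFin h.2)).submatrix f id =
      (A.submatrix f id) * (Yᵀ.submatrix id (sᶜ.orderEmbOfFin h.2)) := by
    ext i j; simp [Matrix.mul_apply]
  rw [hsub2, CTS.cauchy_binet, Finset.mul_sum]
  refine Finset.sum_congr rfl fun g hg => ?_
  have hf' : StrictMono f := fun a b hab => (Finset.mem_filter.1 hf).2 a b hab
  have hg' : StrictMono g := fun a b hab => (Finset.mem_filter.1 hg).2 a b hab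
  have hdA : ((A.submatrix f id).submatrix id g).det = _ := CTS.det_interlace (α := α) f g hf' hg'
  have hdX : ((X.submatrix (s.orderEmbOfFin h.1) id).submatrix id f).det =
    skewSchur hx (lamFun f) (lamSet s h.1) := (CTS.skewSchur_eq hx f s h.1).symm
  have hdY : ((Yᵀ.submatrix id (sᶜ.orderEmbOfFin h.2)).submatrix g id).det =
    skewSchur hy (lamFun g) (lamSet sᶜ h.2) := by
    rw [CTS.skewSchur_eq, ← Matrix.det_transpose]; rfl
  rw [hdA, hdX, hdY]
  by_cases hc : (∀ t, f t ≤ g t) ∧ (∀ s t : Fin k, (s : ℕ) + 1 = t → g s < f t)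
  · rw [if_pos hc, if_pos ((CTS.cond_eq f g).2 hc), one_mul]
  · rw [if_neg hc, if_neg (fun h => hc ((CTS.cond_eq f g).1 h)), zero_mul, mul_zero]
end

section
/- Let m be an even positive integer with m ≥ 2, and let Y = (Y_{i,j})_{1≤i<j≤m} be a skew-symmetric m×m matrix whose entries above the diagonal are independent indeterminates over a field K (so Y_{j,i} = −Y_{i,j} and Y_{i,i} = 0). Then the Pfaffian Pf(Y) is an irreducible element of the polynomial ring K[Y_{i,j} : 1 ≤ i < j ≤ m]. -/
open Matrix

noncomputable def pfE (K : Type*) [Field K] (k : ℕ) (i j : Fin (2*k)) :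
    MvPolynomial {p : Fin (2*k) × Fin (2*k) // p.1 < p.2} K :=
  if h : i < j then
    MvPolynomial.X (⟨(i, j), h⟩ : {p : Fin (2*k) × Fin (2*k) // p.1 < p.2})
  else if h' : j < i then
    - MvPolynomial.X (⟨(j, i), h'⟩ : {p : Fin (2*k) × Fin (2*k) // p.1 < p.2})
  else (0 : MvPolynomial {p : Fin (2*k) × Fin (2*k) // p.1 < p.2} K)

def pfA {k : ℕ} (i : Fin k) : Fin (2*k) := ⟨2*(i:ℕ), by have := i.isLt; omega⟩
def pfB {k : ℕ} (i : Fin k) : Fin (2*k) := ⟨2*(i:ℕ)+1, by have := i.isLt; omega⟩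

def pfNormal {k : ℕ} (σ : Equiv.Perm (Fin (2*k))) : Prop :=
  (∀ i : Fin k, σ (pfA i) < σ (pfB i)) ∧ (∀ i j : Fin k, i < j → σ (pfA i) < σ (pfA j))

instance {k : ℕ} (σ : Equiv.Perm (Fin (2*k))) : Decidable (pfNormal σ) := by
  unfold pfNormal; infer_instance

noncomputable def pfP (K : Type*) [Field K] (k : ℕ) :
    MvPolynomial {p : Fin (2*k) × Fin (2*k) // p.1 < p.2} K :=
  ∑ σ ∈ Finset.univ.filter (fun σ : Equiv.Perm (Fin (2*k)) => pfNormal σ),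
    ((Equiv.Perm.sign σ : ℤ) : MvPolynomial {p : Fin (2*k) × Fin (2*k) // p.1 < p.2} K) *
      ∏ i : Fin k, pfE K k (σ (pfA i)) (σ (pfB i))

noncomputable def pfM {k : ℕ} (σ : Equiv.Perm (Fin (2*k))) :
    {p : Fin (2*k) × Fin (2*k) // p.1 < p.2} →₀ ℕ :=
  ∑ l : Fin k, if h : σ (pfA l) < σ (pfB l) then
    Finsupp.single ⟨(σ (pfA l), σ (pfB l)), h⟩ 1 else 0

theorem pfM_ne {k : ℕ} (σ : Equiv.Perm (Fin (2*k))) (hσ : pfNormal σ)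
    (p : {p : Fin (2*k) × Fin (2*k) // p.1 < p.2}) :
    pfM σ p ≠ 0 ↔ ∃ l : Fin k, σ (pfA l) = p.1.1 ∧ σ (pfB l) = p.1.2 := by
  unfold pfM
  rw [Finsupp.finsetSum_apply, Ne, Finset.sum_eq_zero_iff]
  push Not
  constructor
  · rintro ⟨l, -, hl⟩
    refine ⟨l, ?_⟩
    rw [dif_pos (hσ.1 l), Finsupp.single_apply] at hl
    split_ifs at hl with h
    · rw [← h]; simp
    · simp at hl
  · rintro ⟨l, h1, h2⟩
    refine ⟨l, Finset.mem_univ _, ?_⟩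
    rw [dif_pos (hσ.1 l), Finsupp.single_apply, if_pos]
    · simp
    · ext <;> simp [h1, h2]

theorem pfM_inj {k : ℕ} (σ τ : Equiv.Perm (Fin (2*k))) (hσ : pfNormal σ) (hτ : pfNormal τ)
    (h : pfM σ = pfM τ) : σ = τ := by
  have key : ∀ σ τ : Equiv.Perm (Fin (2*k)), pfNormal σ → pfNormal τ → pfM σ = pfM τ →
      ∀ l, ∃ l', τ (pfA l') = σ (pfA l) ∧ τ (pfB l') = σ (pfB l) := by
    intro σ τ hσ hτ h l
    have := (pfM_ne σ hσ ⟨(σ (pfA l), σ (pfB l)), hσ.1 l⟩).2 ⟨l, rfl, rfl⟩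
    rw [h] at this
    exact (pfM_ne τ hτ _).1 this
  have hs : StrictMono (fun l : Fin k => σ (pfA l)) := fun i j hij => hσ.2 i j hij
  have ht : StrictMono (fun l : Fin k => τ (pfA l)) := fun i j hij => hτ.2 i j hij
  have hr : (fun l : Fin k => σ (pfA l)) = (fun l : Fin k => τ (pfA l)) := by
    rw [← StrictMono.range_inj hs ht]
    ext x
    constructor
    · rintro ⟨l, rfl⟩
      obtain ⟨l', h1, -⟩ := key σ τ hσ hτ h l
      exact ⟨l', h1⟩
    · rintro ⟨l, rfl⟩
      obtain ⟨l', h1, -⟩ := key τ σ hτ hσ h.symm l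
      exact ⟨l', h1⟩
  have hA : ∀ l, σ (pfA l) = τ (pfA l) := fun l => congrFun hr l
  have hB : ∀ l, σ (pfB l) = τ (pfB l) := by
    intro l
    obtain ⟨l', h1, h2⟩ := key σ τ hσ hτ h l
    have : l' = l := by
      apply ht.injective
      simp only [h1, hA]
    subst this
    exact h2.symm
  ext1 x
  have hx := x.isLt
  rcases Nat.even_or_odd' (x : ℕ) with ⟨c, hc | hc⟩
  · have : x = pfA (⟨c, by omega⟩ : Fin k) := by ext; simp [pfA, hc]
    rw [this, hA]
  · have : x = pfB (⟨c, by omega⟩ : Fin k) := by ext; simp [pfB, hc]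
    rw [this, hB]

theorem pfE_prod (K : Type*) [Field K] {k : ℕ} (σ : Equiv.Perm (Fin (2*k))) (hσ : pfNormal σ) :
    ∏ i : Fin k, pfE K k (σ (pfA i)) (σ (pfB i)) = MvPolynomial.monomial (pfM σ) 1 := by
  unfold pfM
  rw [MvPolynomial.monomial_sum_one]
  refine Finset.prod_congr rfl fun l _ => ?_
  rw [dif_pos (hσ.1 l), pfE, dif_pos (hσ.1 l)]
  rfl

theorem pfP_coeff (K : Type*) [Field K] {k : ℕ} (τ : Equiv.Perm (Fin (2*k))) (hτ : pfNormal τ) :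
    MvPolynomial.coeff (pfM τ) (pfP K k) ≠ 0 := by
  have hC : ∀ z : ℤ, ((z : ℤ) : MvPolynomial {p : Fin (2*k) × Fin (2*k) // p.1 < p.2} K)
      = MvPolynomial.C (z : K) := fun z => by simp
  have : MvPolynomial.coeff (pfM τ) (pfP K k) = ((Equiv.Perm.sign τ : ℤ) : K) := by
    unfold pfP
    rw [MvPolynomial.coeff_sum, Finset.sum_eq_single τ]
    · rw [pfE_prod K τ hτ, hC, MvPolynomial.coeff_C_mul, MvPolynomial.coeff_monomial, if_pos rfl,
        mul_one]
    · intro σ hσ hne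
      have hσ' : pfNormal σ := by simpa using hσ
      rw [pfE_prod K σ hσ', hC, MvPolynomial.coeff_C_mul, MvPolynomial.coeff_monomial, if_neg,
        mul_zero]
      exact fun h => hne (pfM_inj σ τ hσ' hτ h)
    · intro h
      exact absurd (by simpa using hτ) h
  rw [this]
  rcases Int.units_eq_one_or (Equiv.Perm.sign τ) with h | h <;> rw [h] <;> simp

/-- the star matching permutation -/
def pfStarFun {k : ℕ} (j : Fin (2*k)) (p : Fin (2*k)) : Fin (2*k) :=
  if (p : ℕ) = 0 then p else if (p : ℕ) = 1 then j
  else if (p : ℕ) ≤ j then ⟨p - 1, by have := p.isLt; omega⟩ else p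

theorem pfStarFun_inj {k : ℕ} (j : Fin (2*k)) (hj : 0 < (j : ℕ)) :
    Function.Injective (pfStarFun j) := by
  intro p q h
  have h' := congrArg Fin.val h
  unfold pfStarFun at h'
  ext
  split_ifs at h' <;> (try simp at h') <;> omega

theorem pf_star {k : ℕ} (j : Fin (2*k)) (hj : 0 < (j : ℕ)) :
    ∃ σ : Equiv.Perm (Fin (2*k)), pfNormal σ ∧
      ∃ l : Fin k, ((σ (pfA l) : Fin (2*k)) : ℕ) = 0 ∧ σ (pfB l) = j := by
  have hjl := j.isLt
  refine ⟨Equiv.ofBijective (pfStarFun j) (Finite.injective_iff_bijective.1 (pfStarFun_inj j hj)),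
    ⟨?_, ?_⟩, ⟨0, by omega⟩, ?_, ?_⟩
  · intro i
    simp only [Equiv.ofBijective_apply, Fin.lt_def, pfStarFun, pfA, pfB]
    split_ifs <;> simp <;> omega
  · intro i i' hii
    rw [Fin.lt_def] at hii
    simp only [Equiv.ofBijective_apply, Fin.lt_def, pfStarFun, pfA]
    split_ifs <;> simp <;> omega
  · simp [pfStarFun, pfA]
  · simp [pfStarFun, pfB]

theorem pf_mem_vars (K : Type*) [Field K] {k : ℕ}
    (e : {p : Fin (2*k) × Fin (2*k) // p.1 < p.2}) (he : (e.1.1 : ℕ) = 0) :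
    e ∈ (pfP K k).vars := by
  have h2 := e.2
  rw [Fin.lt_def] at h2
  obtain ⟨σ, hσ, l, h0, h1⟩ := pf_star e.1.2 (by omega)
  rw [MvPolynomial.mem_vars]
  refine ⟨pfM σ, MvPolynomial.mem_support_iff.2 (pfP_coeff K σ hσ), ?_⟩
  rw [Finsupp.mem_support_iff, pfM_ne σ hσ]
  exact ⟨l, by ext; omega, h1⟩

/-- grading by incidence with the vertex `v` -/
noncomputable def pfPhi (K : Type*) [Field K] (k : ℕ) (v : Fin (2*k)) :
    MvPolynomial {p : Fin (2*k) × Fin (2*k) // p.1 < p.2} K →ₐ[K]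
      Polynomial (MvPolynomial {p : Fin (2*k) × Fin (2*k) // p.1 < p.2} K) :=
  MvPolynomial.aeval fun e => Polynomial.C (MvPolynomial.X e) *
    Polynomial.X ^ (if e.1.1 = v ∨ e.1.2 = v then 1 else 0)

theorem pfPhi_P (K : Type*) [Field K] {k : ℕ} (v : Fin (2*k)) :
    pfPhi K k v (pfP K k) = Polynomial.C (pfP K k) * Polynomial.X := by
  unfold pfP
  rw [map_sum, map_sum, Finset.sum_mul]
  refine Finset.sum_congr rfl fun σ hσ => ?_
  have hσ' : pfNormal σ := by simpa using hσ
  rw [map_mul, map_mul, map_intCast, map_intCast, mul_assoc]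
  congr 1
  rw [map_prod, map_prod]
  have hE : ∀ l, pfPhi K k v (pfE K k (σ (pfA l)) (σ (pfB l))) =
      Polynomial.C (pfE K k (σ (pfA l)) (σ (pfB l))) *
        Polynomial.X ^ (if σ (pfA l) = v ∨ σ (pfB l) = v then 1 else 0) := by
    intro l
    rw [pfE, dif_pos (hσ'.1 l), pfPhi, MvPolynomial.aeval_X]
  rw [Finset.prod_congr rfl fun l _ => hE l, Finset.prod_mul_distrib, Finset.prod_pow_eq_pow_sum]
  congr 1
  have hlt := (σ.symm v).isLt
  have hc : ∀ l : Fin k, (σ (pfA l) = v ∨ σ (pfB l) = v) ↔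
      l = ⟨((σ.symm v : Fin (2*k)) : ℕ) / 2, by omega⟩ := by
    intro l
    rw [← Equiv.eq_symm_apply, ← Equiv.eq_symm_apply, Fin.ext_iff, Fin.ext_iff, Fin.ext_iff]
    simp only [pfA, pfB]
    omega
  simp only [hc]
  simp

theorem pfPhi_vars (K : Type*) [Field K] {k : ℕ} (v : Fin (2*k))
    (h : MvPolynomial {p : Fin (2*k) × Fin (2*k) // p.1 < p.2} K)
    (hd : (pfPhi K k v h).natDegree = 0)
    (e : {p : Fin (2*k) × Fin (2*k) // p.1 < p.2}) (he : e.1.1 = v ∨ e.1.2 = v) :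
    e ∉ h.vars := by
  classical
  obtain ⟨c, hc⟩ := Polynomial.natDegree_eq_zero.1 hd
  have h1 : Polynomial.aeval (R := MvPolynomial {p : Fin (2*k) × Fin (2*k) // p.1 < p.2} K) 1
      (pfPhi K k v h) = h := by
    have : ((Polynomial.aeval (R := MvPolynomial {p : Fin (2*k) × Fin (2*k) // p.1 < p.2} K)
        (1 : MvPolynomial {p : Fin (2*k) × Fin (2*k) // p.1 < p.2} K)).restrictScalars K).comp
        (pfPhi K k v) = AlgHom.id K _ := by
      ext1 i
      by_cases hi : i.1.1 = v ∨ i.1.2 = v <;> simp [pfPhi, hi]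
    exact DFunLike.congr_fun this h
  have h0 : Polynomial.aeval (R := MvPolynomial {p : Fin (2*k) × Fin (2*k) // p.1 < p.2} K) 0
      (pfPhi K k v h) = MvPolynomial.bind₁ (fun e' : {p : Fin (2*k) × Fin (2*k) // p.1 < p.2} =>
        if e'.1.1 = v ∨ e'.1.2 = v then (0 : MvPolynomial _ K) else MvPolynomial.X e') h := by
    have : ((Polynomial.aeval (R := MvPolynomial {p : Fin (2*k) × Fin (2*k) // p.1 < p.2} K)
        (0 : MvPolynomial {p : Fin (2*k) × Fin (2*k) // p.1 < p.2} K)).restrictScalars K).comp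
        (pfPhi K k v) = MvPolynomial.bind₁ (fun e' => if e'.1.1 = v ∨ e'.1.2 = v then
          (0 : MvPolynomial _ K) else MvPolynomial.X e') := by
      ext1 i
      by_cases hi : i.1.1 = v ∨ i.1.2 = v <;> simp [pfPhi, hi]
    exact DFunLike.congr_fun this h
  rw [← hc] at h0 h1
  simp only [Polynomial.aeval_C, Algebra.algebraMap_self, RingHom.id_apply] at h0 h1
  rw [← h1, h0]
  intro hm
  have := MvPolynomial.vars_bind₁ _ _ hm
  rw [Finset.mem_biUnion] at this
  obtain ⟨e', -, h2⟩ := this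
  split_ifs at h2 with h3
  · simp at h2
  · rw [MvPolynomial.vars_X, Finset.mem_singleton] at h2
    subst h2
    exact h3 he

theorem pfP_irreducible (K : Type*) [Field K] (k : ℕ) (hk : 0 < k) : Irreducible (pfP K k) := by
  have hv0 : 0 < 2*k := by omega
  have hmem : ∀ j : Fin (2*k), ∀ hj : (⟨0, hv0⟩ : Fin (2*k)) < j,
      (⟨(⟨0, hv0⟩, j), hj⟩ : {p : Fin (2*k) × Fin (2*k) // p.1 < p.2}) ∈ (pfP K k).vars :=
    fun j hj => pf_mem_vars K _ rfl
  have hne : pfP K k ≠ 0 := by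
    intro h
    have := hmem ⟨1, by omega⟩ (by simp [Fin.lt_def])
    rw [h] at this
    simp at this
  have hdeg : ∀ v, (pfPhi K k v (pfP K k)).natDegree = 1 := by
    intro v
    rw [pfPhi_P, Polynomial.natDegree_C_mul_X _ hne]
  -- main claim
  have main : ∀ g h : MvPolynomial {p : Fin (2*k) × Fin (2*k) // p.1 < p.2} K,
      pfP K k = g * h → (pfPhi K k ⟨0, hv0⟩ h).natDegree = 0 → IsUnit h := by
    intro g h hgh h0
    have hadd : ∀ v, (pfPhi K k v g).natDegree + (pfPhi K k v h).natDegree = 1 := by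
      intro v
      have hz : pfPhi K k v g * pfPhi K k v h ≠ 0 := by
        rw [← map_mul, ← hgh]
        intro hz
        have := hdeg v
        rw [hz] at this
        simp at this
      rw [← Polynomial.natDegree_mul (left_ne_zero_of_mul hz) (right_ne_zero_of_mul hz),
        ← map_mul, ← hgh, hdeg]
    have hall : ∀ v, (pfPhi K k v h).natDegree = 0 := by
      intro v
      by_cases hv : (⟨0, hv0⟩ : Fin (2*k)) < v
      · by_contra hcon
        have hg0 : (pfPhi K k v g).natDegree = 0 := by have := hadd v; omega
        have hm := hmem v hv
        classical
        rw [hgh] at hm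
        rcases Finset.mem_union.1 (MvPolynomial.vars_mul g h hm) with hm | hm
        · exact pfPhi_vars K v g hg0 _ (Or.inr rfl) hm
        · exact pfPhi_vars K _ h h0 _ (Or.inl rfl) hm
      · have : v = ⟨0, hv0⟩ := by
          ext
          simp [Fin.lt_def] at hv
          simpa using hv
        rw [this, h0]
    have hvars : h.vars = ∅ := by
      rw [Finset.eq_empty_iff_forall_notMem]
      exact fun e => pfPhi_vars K e.1.1 h (hall _) e (Or.inl rfl)
    obtain ⟨c, hcc⟩ : ∃ c, h = MvPolynomial.C c := ⟨_, MvPolynomial.vars_eq_empty_iff_eq_C.1 hvars⟩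
    subst hcc
    have hc : c ≠ 0 := by
      rintro rfl
      apply hne
      rw [hgh, map_zero, mul_zero]
    exact (IsUnit.mk0 c hc).map MvPolynomial.C
  refine ⟨?_, ?_⟩
  · intro hu
    have := Polynomial.natDegree_eq_zero_of_isUnit (hu.map (pfPhi K k ⟨0, hv0⟩))
    rw [hdeg] at this
    omega
  · intro g h hgh
    have hz : pfPhi K k ⟨0, hv0⟩ g * pfPhi K k ⟨0, hv0⟩ h ≠ 0 := by
      rw [← map_mul, ← hgh]
      intro hz
      have := hdeg ⟨0, hv0⟩
      rw [hz] at this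
      simp at this
    have hadd := hdeg ⟨0, hv0⟩
    rw [hgh, map_mul,
      Polynomial.natDegree_mul (left_ne_zero_of_mul hz) (right_ne_zero_of_mul hz)] at hadd
    rcases Nat.eq_zero_or_pos (pfPhi K k ⟨0, hv0⟩ h).natDegree with h0 | h0
    · exact Or.inr (main g h hgh h0)
    · exact Or.inl (main h g (hgh.trans (mul_comm g h)) (by omega))

/-- The Pfaffian of the generic skew-symmetric matrix of even size `m = 2k ≥ 2`,
whose entries above the diagonal are independent indeterminates over a field `K`,
is an irreducible polynomial. -/
theorem pfaffian_irreducible (K : Type*) [Field K] (k : ℕ) (hk : 0 < k) :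
    Irreducible
      (pfaffian (Matrix.of fun i j : Fin (2*k) =>
        if h : i < j then
          MvPolynomial.X (⟨(i, j), h⟩ : {p : Fin (2*k) × Fin (2*k) // p.1 < p.2})
        else if h' : j < i then
          - MvPolynomial.X (⟨(j, i), h'⟩ : {p : Fin (2*k) × Fin (2*k) // p.1 < p.2})
        else (0 : MvPolynomial {p : Fin (2*k) × Fin (2*k) // p.1 < p.2} K))) := by
  have h := pfP_irreducible K k hk
  convert h using 1
  unfold pfaffian pfP
  refine Finset.sum_congr ?_ fun σ _ => rfl
  ext σ
  simp only [Finset.mem_filter]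
  rfl
end
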